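/- Let (f_n) and (g_n) be uniformly attracting sequences of automorphisms of ℂ² with constants 0<C<D<1, and let k be a positive integer with D^{k+1} < C. Suppose (h_n) is a sequence of holomorphic maps defined on the unit ball, uniformly bounded there, with h_n(0)=0 and Dh_n(0)=Id, such that for every n the Taylor polynomials of degree k at 0 of g_n∘h_n and of h_{n+1}∘f_n coincide. Then Ω_{(f_n)} is biholomorphic to Ω_{(g_n)}. -/

import Mathlib

open Set Filter Metric Topology Asymptotics

noncomputable section

/-- An automorphism of ℂ²: a biholomorphic map of ℂ² onto itself. -/
def IsAutomorphism (f : (ℂ × ℂ) → (ℂ × ℂ)) : Prop :=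
  AnalyticOn ℂ f Set.univ ∧
    ∃ g : (ℂ × ℂ) → (ℂ × ℂ), AnalyticOn ℂ g Set.univ ∧
      Function.LeftInverse g f ∧ Function.RightInverse g f

/-- `seqComp f n = f n ∘ ⋯ ∘ f 0`. -/
def seqComp (f : ℕ → (ℂ × ℂ) → (ℂ × ℂ)) : ℕ → (ℂ × ℂ) → (ℂ × ℂ)
  | 0 => f 0
  | n + 1 => f (n + 1) ∘ seqComp f n

/-- The basin of attraction of the sequence `(f n)`. -/
def basin (f : ℕ → (ℂ × ℂ) → (ℂ × ℂ)) : Set (ℂ × ℂ) :=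
  {z | Tendsto (fun n => seqComp f n z) atTop (𝓝 0)}

/-- A sequence of maps fixing the origin is uniformly attracting with constants `C < D`
if `C‖z‖ ≤ ‖f n z‖ ≤ D‖z‖` on the open unit ball. -/
def UniformlyAttracting (f : ℕ → (ℂ × ℂ) → (ℂ × ℂ)) (C D : ℝ) : Prop :=
  (∀ n, f n 0 = 0) ∧
    ∀ n, ∀ z : ℂ × ℂ, ‖z‖ < 1 → C * ‖z‖ ≤ ‖f n z‖ ∧ ‖f n z‖ ≤ D * ‖z‖

/-- `U` is biholomorphic to `V`. -/
def BiholomorphicTo (U V : Set (ℂ × ℂ)) : Prop :=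
  ∃ Φ Ψ : (ℂ × ℂ) → (ℂ × ℂ), AnalyticOn ℂ Φ U ∧ AnalyticOn ℂ Ψ V ∧
    MapsTo Φ U V ∧ MapsTo Ψ V U ∧
    (∀ z ∈ U, Ψ (Φ z) = z) ∧ (∀ w ∈ V, Φ (Ψ w) = w)

/-- `f` has order of contact `k`: `f(z) = ℓ(z) + O(‖z‖^k)` near `0` with `ℓ` linear. -/
def OrderOfContact (f : (ℂ × ℂ) → (ℂ × ℂ)) (k : ℕ) : Prop :=
  ∃ l : (ℂ × ℂ) →L[ℂ] (ℂ × ℂ),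
    (fun z => f z - l z) =O[𝓝 (0 : ℂ × ℂ)] fun z => ‖z‖ ^ k

open scoped BoundedContinuousFunction in
/-- A bounded continuous function whose absolute value is bounded below by a positive constant is
invertible, with pointwise inverse. -/
theorem BoundedContinuousFunction.isUnit_of_le_norm {X : Type*} [TopologicalSpace X]
    (u : X →ᵇ ℂ) {ε : ℝ} (hε : 0 < ε) (hu : ∀ x, ε ≤ ‖u x‖) :
    IsUnit u ∧ ∀ x, Ring.inverse u x = (u x)⁻¹ := by
  have hne : ∀ x, u x ≠ 0 := fun x => norm_pos_iff.1 (hε.trans_le (hu x))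
  let v : X →ᵇ ℂ := BoundedContinuousFunction.ofNormedAddCommGroup (fun x => (u x)⁻¹)
    (u.continuous.inv₀ hne) ε⁻¹ (fun x => by
      rw [norm_inv]
      exact inv_anti₀ hε (hu x))
  have huv : u * v = 1 := by
    ext x
    exact mul_inv_cancel₀ (hne x)
  have hvu : v * u = 1 := by rw [mul_comm, huv]
  have h : Ring.inverse u = v := Ring.inverse_unit ⟨u, v, huv, hvu⟩
  exact ⟨⟨⟨u, v, huv, hvu⟩, rfl⟩, fun x => by rw [h]; rfl⟩

open scoped BoundedContinuousFunction in
open MeasureTheory in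
/-- Integration of bounded continuous functions against a vector-valued integrable weight. -/
def weightedIntegralCLM {X F : Type*} [TopologicalSpace X] [MeasurableSpace X]
    [OpensMeasurableSpace X] [NormedAddCommGroup F]
    [NormedSpace ℂ F] (μ : Measure X) (m : X → F) (hm : Integrable m μ) :
    (X →ᵇ ℂ) →L[ℂ] F :=
  have hi : ∀ φ : X →ᵇ ℂ, Integrable (fun x => φ x • m x) μ := fun φ =>
    hm.bdd_smul ‖φ‖ φ.continuous.aestronglyMeasurable
      (Eventually.of_forall φ.norm_coe_le_norm)
  LinearMap.mkContinuous
    { toFun := fun φ => ∫ x, φ x • m x ∂μ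
      map_add' := fun φ ψ => by
        simp only [BoundedContinuousFunction.coe_add, Pi.add_apply, add_smul]
        exact integral_add (hi φ) (hi ψ)
      map_smul' := fun a φ => by
        simp only [BoundedContinuousFunction.coe_smul, smul_assoc, RingHom.id_apply]
        exact integral_smul a _ }
    (∫ x, ‖m x‖ ∂μ) (fun φ => by
      rw [mul_comm, ← integral_const_mul]
      refine norm_integral_le_of_norm_le (hm.norm.const_mul _) (Eventually.of_forall fun x => ?_)
      rw [norm_smul]
      gcongr
      exact φ.norm_coe_le_norm x)

theorem le_norm_circleMap_sub {c z : ℂ} {R : ℝ} (hR : 0 ≤ R) (θ : ℝ) :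
    R - dist z c ≤ ‖circleMap c R θ - z‖ := by
  have h := dist_triangle (circleMap c R θ) z c
  have h2 : dist (circleMap c R θ) c = R := circleMap_mem_sphere c hR θ
  rw [← dist_eq_norm]
  linarith

open scoped BoundedContinuousFunction in
open MeasureTheory in
/-- **Osgood's lemma** in two variables: a continuous function which is holomorphic in
each variable separately is analytic. -/
theorem analyticOnNhd_of_continuousOn_of_separately {F : Type*} [NormedAddCommGroup F]
    [NormedSpace ℂ F] [CompleteSpace F] {f : ℂ × ℂ → F} {c : ℂ × ℂ} {R' : ℝ}
    (hc : ContinuousOn f (ball c R'))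
    (h1 : ∀ w ∈ ball c.2 R', DifferentiableOn ℂ (fun z => f (z, w)) (ball c.1 R'))
    (h2 : ∀ z ∈ ball c.1 R', DifferentiableOn ℂ (fun w => f (z, w)) (ball c.2 R')) :
    AnalyticOnNhd ℂ f (ball c R') := by
  intro x hx
  obtain ⟨R, hxR, hRR⟩ := exists_between (mem_ball.1 hx)
  have hR : 0 < R := dist_nonneg.trans_lt hxR
  have hsub : ∀ a : ℂ, closedBall a R ⊆ ball a R' := fun _ => closedBall_subset_ball hRR
  have hcirc : ∀ (a : ℂ) θ, circleMap a R θ ∈ closedBall a R := fun a θ =>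
    circleMap_mem_closedBall a hR.le θ
  have hball : ∀ p : ℂ × ℂ, p.1 ∈ ball c.1 R' → p.2 ∈ ball c.2 R' → p ∈ ball c R' := by
    intro p hp1 hp2
    rw [← ball_prod_same]
    exact ⟨hp1, hp2⟩
  let a1 : ℝ × ℝ →ᵇ ℂ := BoundedContinuousFunction.ofNormedAddCommGroup
    (fun p => circleMap c.1 R p.1) (by fun_prop) (‖c.1‖ + R) (fun p => by
      have := norm_add_le c.1 (circleMap 0 R p.1)
      rw [norm_circleMap_zero, abs_of_pos hR] at this
      simpa [circleMap] using this)
  let a2 : ℝ × ℝ →ᵇ ℂ := BoundedContinuousFunction.ofNormedAddCommGroup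
    (fun p => circleMap c.2 R p.2) (by fun_prop) (‖c.2‖ + R) (fun p => by
      have := norm_add_le c.2 (circleMap 0 R p.2)
      rw [norm_circleMap_zero, abs_of_pos hR] at this
      simpa [circleMap] using this)
  let u : ℂ × ℂ → (ℝ × ℝ →ᵇ ℂ) := fun y => (a1 - y.1 • 1) * (a2 - y.2 • 1)
  have hu : ∀ y p, u y p = (circleMap c.1 R p.1 - y.1) * (circleMap c.2 R p.2 - y.2) := by
    intro y p
    simp [u, a1, a2]
  have hunit : ∀ y ∈ ball c R, IsUnit (u y) ∧ ∀ p, Ring.inverse (u y) p = (u y p)⁻¹ := by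
    intro y hy
    rw [← ball_prod_same] at hy
    have e1 : 0 < R - dist y.1 c.1 := sub_pos.2 hy.1
    have e2 : 0 < R - dist y.2 c.2 := sub_pos.2 hy.2
    refine (u y).isUnit_of_le_norm (mul_pos e1 e2) fun p => ?_
    rw [hu, norm_mul]
    exact mul_le_mul (le_norm_circleMap_sub hR.le _) (le_norm_circleMap_sub hR.le _) e2.le
      (norm_nonneg _)
  let m : ℝ × ℝ → F := fun p => (deriv (circleMap c.1 R) p.1 * deriv (circleMap c.2 R) p.2) •
    f (circleMap c.1 R p.1, circleMap c.2 R p.2)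
  have hm : Continuous m := by
    have hcomp : Continuous fun p : ℝ × ℝ => f (circleMap c.1 R p.1, circleMap c.2 R p.2) :=
      hc.comp_continuous (by fun_prop) fun p => hball _ (hsub _ (hcirc _ _)) (hsub _ (hcirc _ _))
    simp only [m, deriv_circleMap]
    exact Continuous.smul (by fun_prop) hcomp
  let S : Set (ℝ × ℝ) := Ioc 0 (2 * Real.pi) ×ˢ Ioc 0 (2 * Real.pi)
  have hK : IsCompact (Icc 0 (2 * Real.pi) ×ˢ Icc 0 (2 * Real.pi)) :=
    isCompact_Icc.prod isCompact_Icc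
  have hSK : S ⊆ Icc 0 (2 * Real.pi) ×ˢ Icc 0 (2 * Real.pi) :=
    prod_mono Ioc_subset_Icc_self Ioc_subset_Icc_self
  have hmint : ∀ m' : ℝ × ℝ → F, Continuous m' → IntegrableOn m' S (volume.prod volume) :=
    fun m' hm' => (hm'.continuousOn.integrableOn_compact hK).mono_set hSK
  let L := weightedIntegralCLM ((volume.prod volume).restrict S) m (hmint m hm)
  have hLeq : ∀ φ, L φ = ∫ p in S, φ p • m p ∂(volume.prod volume) := fun φ => rfl
  have hanal : AnalyticAt ℂ (fun y => ((2 * Real.pi * Complex.I : ℂ)⁻¹ *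
      (2 * Real.pi * Complex.I : ℂ)⁻¹) • L (Ring.inverse (u y))) x := by
    have hua : AnalyticAt ℂ u x := by
      have e1 : AnalyticAt ℂ (fun y : ℂ × ℂ => a1 - y.1 • (1 : ℝ × ℝ →ᵇ ℂ)) x :=
        analyticAt_const.sub (analyticAt_fst.smul analyticAt_const)
      have e2 : AnalyticAt ℂ (fun y : ℂ × ℂ => a2 - y.2 • (1 : ℝ × ℝ →ᵇ ℂ)) x :=
        analyticAt_const.sub (analyticAt_snd.smul analyticAt_const)
      exact e1.mul e2
    obtain ⟨v, hv⟩ := (hunit x hxR).1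
    have hinv : AnalyticAt ℂ Ring.inverse (u x) := hv ▸ analyticAt_inverse v
    exact analyticAt_const.smul
      ((L.analyticAt (Ring.inverse (u x))).comp (f := Ring.inverse ∘ u) (hinv.comp hua))
  refine hanal.congr ?_
  filter_upwards [isOpen_ball.mem_nhds (show x ∈ ball c R from hxR)] with y hy
  have hy' := hy
  rw [← ball_prod_same] at hy'
  have c1 : ∀ w ∈ ball c.2 R', (2 * Real.pi * Complex.I : ℂ)⁻¹ •
      (∮ ζ in C(c.1, R), (ζ - y.1)⁻¹ • f (ζ, w)) = f (y.1, w) := fun w hw =>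
    (((h1 w hw).mono (hsub _)).mono closure_ball_subset_closedBall).diffContOnCl
      |>.two_pi_i_inv_smul_circleIntegral_sub_inv_smul hy'.1
  have c2 : ∀ z ∈ ball c.1 R', (2 * Real.pi * Complex.I : ℂ)⁻¹ •
      (∮ η in C(c.2, R), (η - y.2)⁻¹ • f (z, η)) = f (z, y.2) := fun z hz =>
    (((h2 z hz).mono (hsub _)).mono closure_ball_subset_closedBall).diffContOnCl
      |>.two_pi_i_inv_smul_circleIntegral_sub_inv_smul hy'.2
  have e : f y = f (y.1, y.2) := rfl
  have hpi : (0 : ℝ) ≤ 2 * Real.pi := Real.two_pi_pos.le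
  rw [e, ← c1 y.2 (hsub _ (ball_subset_closedBall hy'.2)), hLeq, mul_smul]
  congr 1
  rw [setIntegral_prod (fun p => (Ring.inverse (u y)) p • m p)
    (hmint _ ((Ring.inverse (u y)).continuous.smul hm)), circleIntegral,
    intervalIntegral.integral_of_le hpi, ← integral_smul]
  refine integral_congr_ae (Eventually.of_forall fun θ => ?_)
  simp only
  rw [← c2 _ (hsub _ (hcirc c.1 θ)), circleIntegral, intervalIntegral.integral_of_le hpi,
    smul_comm (circleMap c.1 R θ - y.1)⁻¹, smul_comm (deriv (circleMap c.1 R) θ)]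
  congr 1
  rw [← integral_smul, ← integral_smul]
  refine integral_congr_ae (Eventually.of_forall fun η => ?_)
  simp only [m, (hunit y hy).2, hu, smul_smul, mul_inv]
  congr 1
  ring

/-- The Weierstrass theorem in two variables: a uniform limit of analytic maps on a ball is
analytic. -/
theorem analyticOnNhd_of_tendstoUniformlyOn {F : Type*} [NormedAddCommGroup F]
    [NormedSpace ℂ F] [CompleteSpace F] {P : ℕ → ℂ × ℂ → F} {f : ℂ × ℂ → F} {c : ℂ × ℂ} {R : ℝ}
    (hP : ∀ j, AnalyticOnNhd ℂ (P j) (ball c R)) (hf : TendstoUniformlyOn P f atTop (ball c R)) :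
    AnalyticOnNhd ℂ f (ball c R) := by
  refine analyticOnNhd_of_continuousOn_of_separately
    (hf.continuousOn (Frequently.of_forall fun j => (hP j).continuousOn)) ?_ ?_
  · intro w hw
    have hmaps : MapsTo (fun z => (z, w)) (ball c.1 R) (ball c R) := fun z hz => by
      rw [← ball_prod_same]
      exact ⟨hz, hw⟩
    refine TendstoLocallyUniformlyOn.differentiableOn (φ := atTop)
      (F := fun j z => P j (z, w)) (TendstoUniformlyOn.tendstoLocallyUniformlyOn ?_)
      (Eventually.of_forall fun j => ?_) isOpen_ball
    · exact (hf.comp fun z => (z, w)).mono hmaps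
    · exact (hP j).differentiableOn.comp (by fun_prop) hmaps
  · intro z hz
    have hmaps : MapsTo (fun w => (z, w)) (ball c.2 R) (ball c R) := fun w hw => by
      rw [← ball_prod_same]
      exact ⟨hz, hw⟩
    refine TendstoLocallyUniformlyOn.differentiableOn (φ := atTop)
      (F := fun j w => P j (z, w)) (TendstoUniformlyOn.tendstoLocallyUniformlyOn ?_)
      (Eventually.of_forall fun j => ?_) isOpen_ball
    · exact (hf.comp fun w => (z, w)).mono hmaps
    · exact (hP j).differentiableOn.comp (by fun_prop) hmaps

section NormedSpace

variable {E F : Type*} [NormedAddCommGroup E] [NormedSpace ℂ E] [NormedAddCommGroup F]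
  [NormedSpace ℂ F]

/-- The higher order Schwarz lemma at the origin. -/
theorem norm_le_of_isLittleO_pow {u : E → F} {R M : ℝ} {n : ℕ}
    (hd : DifferentiableOn ℂ u (ball 0 R)) (hM : ∀ z ∈ ball 0 R, ‖u z‖ ≤ M)
    (h0 : u 0 = 0) (ho : u =o[𝓝 0] fun z => ‖z‖ ^ n) {z : E} (hz : z ∈ ball 0 R) :
    ‖u z‖ ≤ M * (‖z‖ / R) ^ (n + 1) := by
  have := Complex.dist_le_mul_div_pow_of_mapsTo_ball_of_isLittleO (c := (0 : E)) (R₂ := M) (n := n)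
    hd (fun z hz => by simpa [h0] using hM z hz) (by simpa [h0] using ho) hz
  simpa [h0] using this

theorem norm_sub_le_of_fderiv_eq_zero {u : E → F} {R M δ : ℝ}
    (hd : DifferentiableOn ℂ u (ball 0 R)) (hM : ∀ z ∈ ball 0 R, ‖u z‖ ≤ M)
    (h0 : u 0 = 0) (h1 : fderiv ℂ u 0 = 0) (hδ : 0 < δ) (hδR : 2 * δ ≤ R)
    {x y : E} (hx : x ∈ ball 0 δ) (hy : y ∈ ball 0 δ) :
    ‖u x - u y‖ ≤ 8 * M * δ / R ^ 2 * ‖x - y‖ := by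
  have hR : 0 < R := by linarith
  have hM0 : 0 ≤ M := (norm_nonneg _).trans (hM 0 (mem_ball_self hR))
  have ho : u =o[𝓝 0] fun z => ‖z‖ ^ 1 := by
    have := (hd.differentiableAt (ball_mem_nhds 0 hR)).hasFDerivAt
    rw [h1, hasFDerivAt_iff_isLittleO_nhds_zero] at this
    simpa [h0] using this.norm_right
  have hquad : ∀ z ∈ ball (0 : E) (2 * δ), ‖u z‖ ≤ 4 * M * δ ^ 2 / R ^ 2 := by
    intro z hz
    have hz' : ‖z‖ ≤ 2 * δ := (mem_ball_zero_iff.1 hz).le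
    calc ‖u z‖ ≤ M * (‖z‖ / R) ^ 2 :=
          norm_le_of_isLittleO_pow hd hM h0 ho (ball_subset_ball hδR hz)
      _ ≤ M * (2 * δ / R) ^ 2 := by gcongr
      _ = 4 * M * δ ^ 2 / R ^ 2 := by ring
  have hδ' : ∀ w ∈ ball (0 : E) δ, ball w δ ⊆ ball 0 (2 * δ) := fun w hw =>
    ball_subset_ball' (by linarith [mem_ball.1 hw])
  refine (convex_ball (0 : E) δ).norm_image_sub_le_of_norm_fderiv_le (𝕜 := ℂ) (f := u)
    (fun w hw => ?_) (fun w hw => ?_) hy hx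
  · exact hd.differentiableAt (isOpen_ball.mem_nhds (ball_subset_ball (by linarith) hw))
  · have hw2 : w ∈ ball (0 : E) (2 * δ) := hδ' w hw (mem_ball_self hδ)
    calc ‖fderiv ℂ u w‖ ≤ (8 * M * δ ^ 2 / R ^ 2) / δ := by
          refine Complex.norm_fderiv_le_div_of_mapsTo_ball
            (hd.mono ((hδ' w hw).trans (ball_subset_ball hδR))) (fun z hz => ?_) hδ
          rw [mem_closedBall, dist_eq_norm]
          calc ‖u z - u w‖ ≤ ‖u z‖ + ‖u w‖ := norm_sub_le _ _
            _ ≤ 4 * M * δ ^ 2 / R ^ 2 + 4 * M * δ ^ 2 / R ^ 2 :=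
              add_le_add (hquad z (hδ' w hw hz)) (hquad w hw2)
            _ = _ := by ring
      _ = 8 * M * δ / R ^ 2 := by field_simp

/-- Holomorphic maps that are uniformly bounded and vanish to second order at the origin have
uniformly small Lipschitz constants near the origin. -/
theorem exists_lipschitz_of_fderiv_eq_zero (E F : Type*) [NormedAddCommGroup E] [NormedSpace ℂ E]
    [NormedAddCommGroup F] [NormedSpace ℂ F] {R M ε : ℝ} (hR : 0 < R) (hM : 0 ≤ M) (hε : 0 < ε) :
    ∃ δ > 0, δ ≤ R ∧ ∀ u : E → F, DifferentiableOn ℂ u (ball 0 R) → (∀ z ∈ ball 0 R, ‖u z‖ ≤ M) →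
      u 0 = 0 → fderiv ℂ u 0 = 0 →
      ∀ x ∈ ball 0 δ, ∀ y ∈ ball 0 δ, ‖u x - u y‖ ≤ ε * ‖x - y‖ := by
  have hδ : 0 < min (R / 2) (ε * R ^ 2 / (8 * (M + 1))) := by positivity
  have h1 := min_le_left (R / 2) (ε * R ^ 2 / (8 * (M + 1)))
  refine ⟨_, hδ, by linarith, fun u hd hb h0 hu x hx y hy => ?_⟩
  refine (norm_sub_le_of_fderiv_eq_zero hd hb h0 hu hδ (by linarith) hx hy).trans ?_
  have h2 := min_le_right (R / 2) (ε * R ^ 2 / (8 * (M + 1)))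
  rw [le_div_iff₀ (by positivity)] at h2
  gcongr
  rw [div_le_iff₀ (by positivity)]
  nlinarith

/-- Two analytic maps with the same derivatives up to order `k` at the origin differ by
`o(‖z‖ ^ k)`. -/
theorem isLittleO_sub_of_iteratedFDeriv_eq [CompleteSpace F] {a b : E → F} {k : ℕ}
    (ha : AnalyticAt ℂ a 0) (hb : AnalyticAt ℂ b 0)
    (hab : ∀ i ≤ k, iteratedFDeriv ℂ i a 0 = iteratedFDeriv ℂ i b 0) :
    (fun z => a z - b z) =o[𝓝 0] fun z => ‖z‖ ^ k := by
  obtain ⟨p, hp⟩ := ha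
  obtain ⟨q, hq⟩ := hb
  have hpq : ∀ y, p.partialSum (k + 1) y = q.partialSum (k + 1) y := by
    intro y
    refine Finset.sum_congr rfl fun i hi => ?_
    obtain ⟨r, hr⟩ := hp
    obtain ⟨r', hr'⟩ := hq
    have h1 := hr.factorial_smul y i
    rw [hab i (Nat.lt_succ_iff.1 (Finset.mem_range.1 hi)), ← hr'.factorial_smul y i,
      ← Nat.cast_smul_eq_nsmul ℂ, ← Nat.cast_smul_eq_nsmul ℂ] at h1
    exact smul_right_injective F (Nat.cast_ne_zero.2 i.factorial_ne_zero) h1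
  have h := (hp.isBigO_sub_partialSum_pow (k + 1)).sub (hq.isBigO_sub_partialSum_pow (k + 1))
  simp only [hpq, zero_add, sub_sub_sub_cancel_right] at h
  refine h.trans_isLittleO ?_
  have := isLittleO_norm_pow_norm_pow (E' := E) (Nat.lt_succ_self k)
  exact this

/-- The derivative at the origin of a map satisfying `C * ‖z‖ ≤ ‖g z‖` near the origin satisfies
the same bound. -/
theorem le_norm_fderiv_apply {g : E → F} {C : ℝ} (hg : DifferentiableAt ℂ g 0) (hg0 : g 0 = 0)
    (hC : ∀ᶠ z in 𝓝 0, C * ‖z‖ ≤ ‖g z‖) (v : E) : C * ‖v‖ ≤ ‖fderiv ℂ g 0 v‖ := by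
  have hn : Tendsto (fun n : ℕ => ‖(n : ℂ)‖) atTop atTop := by
    simpa using tendsto_natCast_atTop_atTop (R := ℝ)
  have hlim := (hg.hasFDerivAt.lim v hn).norm
  have hz : Tendsto (fun n : ℕ => (n : ℂ)⁻¹ • v) atTop (𝓝 0) := by
    simpa using (tendsto_inv_atTop_nhds_zero_nat (𝕜 := ℂ)).smul_const v
  refine ge_of_tendsto hlim ?_
  filter_upwards [hz.eventually hC, eventually_gt_atTop 0] with n h1 h2
  have h2' : (0 : ℝ) < n := by exact_mod_cast h2
  rw [zero_add, hg0, sub_zero, norm_smul]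
  rw [norm_smul, norm_inv, Complex.norm_natCast] at h1
  rw [Complex.norm_natCast]
  calc C * ‖v‖ = n * (C * ((n : ℝ)⁻¹ * ‖v‖)) := by field_simp
    _ ≤ n * ‖g ((n : ℂ)⁻¹ • v)‖ := by gcongr

/-- Uniform local expansion of the holomorphic maps with `C * ‖z‖ ≤ ‖g z‖ ≤ ‖z‖` on the
unit ball. -/
theorem exists_uniform_expansion (E : Type*) [NormedAddCommGroup E] [NormedSpace ℂ E]
    [FiniteDimensional ℂ E] {C C' : ℝ} (hC' : 0 < C') (hCC : C' < C) :
    ∃ δ > 0, δ ≤ 1 ∧ ∀ g : E → E, DifferentiableOn ℂ g (ball 0 1) → g 0 = 0 →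
      (∀ z ∈ ball 0 1, C * ‖z‖ ≤ ‖g z‖ ∧ ‖g z‖ ≤ ‖z‖) →
      (∀ x ∈ ball 0 δ, ∀ y ∈ ball 0 δ, C' * ‖x - y‖ ≤ ‖g x - g y‖) ∧
      ∀ w ∈ ball 0 (C' * δ), ∃ x ∈ ball 0 δ, g x = w := by
  have : CompleteSpace E := FiniteDimensional.complete ℂ E
  obtain ⟨δ, hδ, hδ1, H⟩ := exists_lipschitz_of_fderiv_eq_zero E E one_pos zero_le_two
    (sub_pos.2 hCC)
  refine ⟨δ, hδ, hδ1, fun g hd h0 hg => ?_⟩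
  have hnhds : ball (0 : E) 1 ∈ 𝓝 0 := ball_mem_nhds 0 one_pos
  have hda := hd.differentiableAt hnhds
  set L := fderiv ℂ g 0 with hL
  have hLlow : ∀ v, C * ‖v‖ ≤ ‖L v‖ :=
    le_norm_fderiv_apply hda h0 (by filter_upwards [hnhds] with z hz using (hg z hz).1)
  have hLup : ‖L‖ ≤ 1 := by
    refine norm_fderiv_le_of_lip' ℂ zero_le_one ?_
    filter_upwards [hnhds] with z hz
    simpa [h0] using (hg z hz).2
  have hLLv : ∀ v, ‖L v‖ ≤ ‖v‖ := fun v => by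
    simpa using L.le_of_opNorm_le hLup v
  have hlip := H (fun z => g z - L z) (hd.sub L.differentiableOn) (fun z hz => by
      have h1 := mem_ball_zero_iff.1 hz
      linarith [norm_sub_le (g z) (L z), (hg z hz).2, hLLv z]) (by simp [h0])
    (by
      rw [fderiv_fun_sub hda L.differentiableAt, ContinuousLinearMap.fderiv, sub_self])
  have hcoe : ((C - C').toNNReal : ℝ) = C - C' := Real.coe_toNNReal _ (sub_pos.2 hCC).le
  have happrox : ApproximatesLinearOn g L (ball 0 δ) (C - C').toNNReal := by
    intro x hx y hy
    rw [hcoe]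
    have := hlip x hx y hy
    rw [map_sub]
    convert this using 2
    abel
  refine ⟨fun x hx y hy => ?_, fun w hw => ?_⟩
  · have h1 := happrox x hx y hy
    have h2 := hLlow (x - y)
    have h3 := norm_sub_norm_le (L (x - y)) (g x - g y)
    rw [norm_sub_rev (L (x - y))] at h3
    rw [hcoe] at h1
    nlinarith
  · have hCpos : 0 < C := hC'.trans hCC
    have hinj : Function.Injective L := by
      refine (injective_iff_map_eq_zero L).2 fun v hv => ?_
      have := hLlow v
      rw [hv, norm_zero] at this
      exact norm_le_zero_iff.1 (nonpos_of_mul_nonpos_right this hCpos)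
    have hsurj : Function.Surjective L := LinearMap.injective_iff_surjective (f := (L : E →ₗ[ℂ] E)).1 hinj
    choose inv hinv using hsurj
    have hCinv : (C⁻¹.toNNReal : ℝ) = C⁻¹ := Real.coe_toNNReal _ (inv_nonneg.2 hCpos.le)
    let N : L.NonlinearRightInverse :=
      { toFun := inv
        nnnorm := C⁻¹.toNNReal
        bound' := fun y => by
          have := hLlow (inv y)
          rw [hinv] at this
          rwa [hCinv, inv_mul_eq_div, le_div_iff₀' hCpos]
        right_inv' := hinv }
    have hw' : ‖w‖ / C' < δ := by
      rw [div_lt_iff₀' hC']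
      exact mem_ball_zero_iff.1 hw
    have hsub : closedBall (0 : E) (‖w‖ / C') ⊆ ball 0 δ := closedBall_subset_ball hw'
    obtain ⟨x, hx, hxw⟩ := happrox.surjOn_closedBall_of_nonlinearRightInverse N
      (by positivity) hsub (show w ∈ _ by
        have hN : (N.nnnorm : ℝ) = C⁻¹ := hCinv
        rw [hN, hcoe, h0, inv_inv, sub_sub_cancel, mul_div_cancel₀ _ hC'.ne',
          mem_closedBall_zero_iff])
    exact ⟨x, hsub hx, hxw⟩

end NormedSpace

/-- The iterated pullback `ginv n ∘ ⋯ ∘ ginv (n + j - 1) ∘ h (n + j) ∘ f (n + j - 1) ∘ ⋯ ∘ f n`. -/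
def pullback {E : Type*} (ginv f h : ℕ → E → E) : ℕ → ℕ → E → E
  | 0 => h
  | j + 1 => fun n x => ginv n (pullback ginv f h j (n + 1) (f n x))

/-- The defect of a conjugation up to order `k` is uniformly `O(‖x‖ ^ (k + 1))` on a ball that
depends only on the bounds. -/
theorem exists_uniform_remainder {E : Type*} [NormedAddCommGroup E] [NormedSpace ℂ E]
    [CompleteSpace E] {f g h : ℕ → E → E} {B : ℝ} {k : ℕ} (hB : 1 ≤ B)
    (hf : ∀ n, AnalyticOnNhd ℂ (f n) univ) (hg : ∀ n, AnalyticOnNhd ℂ (g n) univ)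
    (hf0 : ∀ n, f n 0 = 0) (hg0 : ∀ n, g n 0 = 0)
    (hfD : ∀ n z, ‖z‖ < 1 → ‖f n z‖ ≤ ‖z‖) (hgD : ∀ n z, ‖z‖ < 1 → ‖g n z‖ ≤ ‖z‖)
    (hh : ∀ n, AnalyticOnNhd ℂ (h n) (ball 0 1)) (hh0 : ∀ n, h n 0 = 0)
    (hhB : ∀ n z, ‖z‖ < 1 → ‖h n z‖ ≤ B * ‖z‖)
    (htaylor : ∀ n, ∀ i ≤ k,
      iteratedFDeriv ℂ i (g n ∘ h n) 0 = iteratedFDeriv ℂ i (h (n + 1) ∘ f n) 0)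
    {n : ℕ} {x : E} (hx : ‖x‖ < B⁻¹) :
    ‖g n (h n x) - h (n + 1) (f n x)‖ ≤ (1 + B) * B ^ (k + 1) * ‖x‖ ^ (k + 1) := by
  have hB0 : 0 < B := by linarith
  have hB1 : B⁻¹ ≤ 1 := inv_le_one_of_one_le₀ hB
  have hlt : ∀ z ∈ ball (0 : E) B⁻¹, ‖z‖ < 1 ∧ ‖h n z‖ < 1 := by
    intro z hz
    rw [mem_ball_zero_iff] at hz
    refine ⟨hz.trans_le hB1, (hhB n z (hz.trans_le hB1)).trans_lt ?_⟩
    rwa [← lt_inv_mul_iff₀ hB0, mul_one]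
  have hfz : ∀ z ∈ ball (0 : E) B⁻¹, ‖f n z‖ < 1 := fun z hz =>
    (hfD n z (hlt z hz).1).trans_lt (hlt z hz).1
  have ha : AnalyticOnNhd ℂ (g n ∘ h n) (ball 0 B⁻¹) :=
    (hg n).comp ((hh n).mono (ball_subset_ball hB1)) (mapsTo_univ _ _)
  have hb : AnalyticOnNhd ℂ (h (n + 1) ∘ f n) (ball 0 B⁻¹) :=
    (hh (n + 1)).comp ((hf n).mono (subset_univ _))
      (fun z hz => mem_ball_zero_iff.2 (hfz z hz))
  have h0 : (0 : E) ∈ ball (0 : E) B⁻¹ := mem_ball_self (inv_pos.2 hB0)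
  have key := norm_le_of_isLittleO_pow (u := fun z => (g n ∘ h n) z - (h (n + 1) ∘ f n) z)
    (M := 1 + B) (ha.differentiableOn.sub hb.differentiableOn) (fun z hz => ?_)
    (by simp [hh0, hg0, hf0]) (isLittleO_sub_of_iteratedFDeriv_eq (ha 0 h0) (hb 0 h0) (htaylor n))
    (mem_ball_zero_iff.2 hx)
  · rwa [div_inv_eq_mul, mul_pow, mul_comm (‖x‖ ^ _), ← mul_assoc] at key
  · have h1 := hgD n _ (hlt z hz).2
    have h2 := hhB (n + 1) _ (hfz z hz)
    have h3 := norm_sub_le (g n (h n z)) (h (n + 1) (f n z))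
    have h4 := (hlt z hz).2
    have h5 : B * ‖f n z‖ ≤ B * 1 := by
      gcongr
      exact (hfz z hz).le
    simp only [Function.comp]
    linarith

/-- A conjugation up to order `k` between two uniformly attracting sequences can be corrected to
an exact conjugation on a small ball. -/
theorem exists_exact_conjugation {f g ginv h : ℕ → ℂ × ℂ → ℂ × ℂ} {B C D : ℝ} {k : ℕ}
    (hB : 1 ≤ B) (hD0 : 0 < D) (hD : D < 1) (hk : 1 ≤ k) (hDC : D ^ (k + 1) < C)
    (hf : ∀ n, AnalyticOnNhd ℂ (f n) univ) (hg : ∀ n, AnalyticOnNhd ℂ (g n) univ)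
    (hginv : ∀ n, AnalyticOnNhd ℂ (ginv n) univ)
    (hgl : ∀ n, Function.LeftInverse (ginv n) (g n))
    (hgr : ∀ n, Function.RightInverse (ginv n) (g n))
    (hf0 : ∀ n, f n 0 = 0) (hg0 : ∀ n, g n 0 = 0)
    (hfD : ∀ n z, ‖z‖ < 1 → ‖f n z‖ ≤ D * ‖z‖)
    (hgC : ∀ n z, ‖z‖ < 1 → C * ‖z‖ ≤ ‖g n z‖) (hgD : ∀ n z, ‖z‖ < 1 → ‖g n z‖ ≤ ‖z‖)
    (hh : ∀ n, AnalyticOnNhd ℂ (h n) (ball 0 1)) (hh0 : ∀ n, h n 0 = 0)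
    (hDh : ∀ n, fderiv ℂ (h n) 0 = ContinuousLinearMap.id ℂ (ℂ × ℂ))
    (hhB : ∀ n z, ‖z‖ < 1 → ‖h n z‖ ≤ B * ‖z‖)
    (htaylor : ∀ n, ∀ i ≤ k,
      iteratedFDeriv ℂ i (g n ∘ h n) 0 = iteratedFDeriv ℂ i (h (n + 1) ∘ f n) 0) :
    ∃ r > 0, r ≤ 1 ∧ ∃ Φ : ℕ → ℂ × ℂ → ℂ × ℂ, ∀ n, AnalyticOnNhd ℂ (Φ n) (ball 0 r) ∧
      (∀ x ∈ ball 0 r, ‖Φ n x‖ < 1) ∧ Φ n 0 = 0 ∧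
      HasFDerivAt (Φ n) (ContinuousLinearMap.id ℂ (ℂ × ℂ)) 0 ∧
      ∀ x ∈ ball 0 r, g n (Φ n x) = Φ (n + 1) (f n x) := by
  obtain ⟨C', hDC', hCC'⟩ := exists_between hDC
  have hDk : 0 < D ^ (k + 1) := by positivity
  have hC' : 0 < C' := hDk.trans hDC'
  have hB0 : 0 < B := by linarith
  have hB1 : B⁻¹ ≤ 1 := inv_le_one_of_one_le₀ hB
  obtain ⟨δ, hδ, hδ1, H⟩ := exists_uniform_expansion (ℂ × ℂ) hC' hCC'
  set η := min (C' * δ) 1 with hη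
  have hη0 : 0 < η := by positivity
  have hexp : ∀ n, ∀ v ∈ ball 0 η, ∀ w ∈ ball 0 η,
      ‖ginv n v - ginv n w‖ ≤ C'⁻¹ * ‖v - w‖ := by
    intro n v hv w hw
    obtain ⟨h1, h2⟩ := H (g n) ((hg n).differentiableOn.mono (subset_univ _)) (hg0 n)
      fun z hz => ⟨hgC n z (mem_ball_zero_iff.1 hz), hgD n z (mem_ball_zero_iff.1 hz)⟩
    obtain ⟨x, hx, rfl⟩ := h2 v (ball_subset_ball (min_le_left _ _) hv)
    obtain ⟨y, hy, rfl⟩ := h2 w (ball_subset_ball (min_le_left _ _) hw)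
    rw [hgl, hgl, ← div_eq_inv_mul, le_div_iff₀' hC']
    exact h1 x hx y hy
  set A := (1 + B) * B ^ (k + 1) with hA
  have hA0 : 0 < A := by positivity
  set A' := A / (C' - D ^ (k + 1)) with hA'
  have hsub : 0 < C' - D ^ (k + 1) := sub_pos.2 hDC'
  have hA'0 : 0 < A' := by positivity
  have hA'eq : C'⁻¹ * (A' * D ^ (k + 1) + A) = A' := by
    rw [hA']
    field_simp
    ring
  set r := min B⁻¹ (η / (B + A')) with hr
  have hr0 : 0 < r := by positivity
  have hrB : r ≤ B⁻¹ := min_le_left _ _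
  have hr1 : r ≤ 1 := hrB.trans hB1
  have hsmall : ∀ n, ∀ x ∈ ball (0 : ℂ × ℂ) r, ∀ y : ℂ × ℂ,
      ‖y - h n x‖ ≤ A' * ‖x‖ ^ (k + 1) → y ∈ ball 0 η := by
    intro n x hx y hy
    rw [mem_ball_zero_iff] at hx ⊢
    have hx1 : ‖x‖ < 1 := hx.trans_le hr1
    have h1 : ‖x‖ ^ (k + 1) ≤ ‖x‖ := pow_le_of_le_one (norm_nonneg _) hx1.le k.succ_ne_zero
    have h2 : ‖y‖ ≤ ‖h n x‖ + ‖y - h n x‖ := by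
      simpa using norm_add_le (h n x) (y - h n x)
    have h3 : (B + A') * ‖x‖ < η := by
      rw [← lt_div_iff₀' (by positivity)]
      exact hx.trans_le (min_le_right _ _)
    nlinarith [hhB n x hx1]
  have hhη : ∀ n, ∀ x ∈ ball (0 : ℂ × ℂ) r, h n x ∈ ball 0 η := fun n x hx =>
    hsmall n x hx _ (by simp; positivity)
  have hη1 : ∀ y ∈ ball (0 : ℂ × ℂ) η, ‖y‖ < 1 := fun y hy =>
    (mem_ball_zero_iff.1 hy).trans_le (min_le_right _ _)
  have hfr : ∀ n, MapsTo (f n) (ball 0 r) (ball 0 r) := by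
    intro n x hx
    rw [mem_ball_zero_iff] at hx ⊢
    have := hfD n x (hx.trans_le hr1)
    nlinarith [norm_nonneg x]
  have hfpow : ∀ n, ∀ x ∈ ball (0 : ℂ × ℂ) r,
      ‖f n x‖ ^ (k + 1) ≤ D ^ (k + 1) * ‖x‖ ^ (k + 1) := by
    intro n x hx
    rw [← mul_pow]
    exact pow_le_pow_left₀ (norm_nonneg _)
      (hfD n x ((mem_ball_zero_iff.1 hx).trans_le hr1)) _
  set P := pullback ginv f h with hP
  have hPsucc : ∀ j n x, P (j + 1) n x = ginv n (P j (n + 1) (f n x)) := fun _ _ _ => rfl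
  have hclose : ∀ j n, ∀ x ∈ ball (0 : ℂ × ℂ) r, ‖P j n x - h n x‖ ≤ A' * ‖x‖ ^ (k + 1) := by
    intro j
    induction j with
    | zero =>
      intro n x _
      simp only [hP, pullback, sub_self, norm_zero]
      positivity
    | succ j ih =>
      intro n x hx
      have hfx := hfr n hx
      have h1 := ih (n + 1) (f n x) hfx
      have h2 : g n (h n x) ∈ ball 0 η := mem_ball_zero_iff.2
        ((hgD n _ (hη1 _ (hhη n x hx))).trans_lt (mem_ball_zero_iff.1 (hhη n x hx)))
      have h3 : ‖g n (h n x) - h (n + 1) (f n x)‖ ≤ A * ‖x‖ ^ (k + 1) :=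
        exists_uniform_remainder hB hf hg hf0 hg0
          (fun n z hz => (hfD n z hz).trans (mul_le_of_le_one_left (norm_nonneg _) hD.le))
          hgD hh hh0 hhB htaylor ((mem_ball_zero_iff.1 hx).trans_le hrB)
      have h4 := hexp n _ (hsmall (n + 1) (f n x) hfx _ h1) _ h2
      rw [hgl] at h4
      rw [hPsucc]
      refine h4.trans ?_
      rw [← hA'eq, mul_assoc]
      gcongr
      calc ‖P j (n + 1) (f n x) - g n (h n x)‖
          ≤ ‖P j (n + 1) (f n x) - h (n + 1) (f n x)‖ + ‖g n (h n x) - h (n + 1) (f n x)‖ :=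
            (norm_sub_rev (g n (h n x)) _).symm ▸ norm_sub_le_norm_sub_add_norm_sub _ _ _
        _ ≤ A' * (D ^ (k + 1) * ‖x‖ ^ (k + 1)) + A * ‖x‖ ^ (k + 1) :=
            add_le_add (h1.trans (by gcongr; exact hfpow n x hx)) h3
        _ = (A' * D ^ (k + 1) + A) * ‖x‖ ^ (k + 1) := by ring
  have hPη : ∀ j n, ∀ x ∈ ball (0 : ℂ × ℂ) r, P j n x ∈ ball 0 η := fun j n x hx =>
    hsmall n x hx _ (hclose j n x hx)
  set ρ := C'⁻¹ * D ^ (k + 1) with hρ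
  have hρ0 : 0 ≤ ρ := by positivity
  have hρ1 : ρ < 1 := by rwa [hρ, inv_mul_lt_iff₀ hC', mul_one]
  have hcauchy : ∀ j n, ∀ x ∈ ball (0 : ℂ × ℂ) r,
      ‖P j n x - P (j + 1) n x‖ ≤ A' * ‖x‖ ^ (k + 1) * ρ ^ j := by
    intro j
    induction j with
    | zero =>
      intro n x hx
      rw [pow_zero, mul_one, norm_sub_rev]
      exact hclose 1 n x hx
    | succ j ih =>
      intro n x hx
      have hfx := hfr n hx
      rw [hPsucc, hPsucc (j + 1)]
      refine (hexp n _ (hPη _ _ _ hfx) _ (hPη _ _ _ hfx)).trans ?_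
      calc C'⁻¹ * ‖P j (n + 1) (f n x) - P (j + 1) (n + 1) (f n x)‖
          ≤ C'⁻¹ * (A' * (D ^ (k + 1) * ‖x‖ ^ (k + 1)) * ρ ^ j) := by
            gcongr
            refine (ih (n + 1) (f n x) hfx).trans ?_
            gcongr
            exact hfpow n x hx
        _ = A' * ‖x‖ ^ (k + 1) * ρ ^ (j + 1) := by rw [hρ]; ring
  have hdist : ∀ n, ∀ x ∈ ball (0 : ℂ × ℂ) r, ∀ j,
      dist (P j n x) (P (j + 1) n x) ≤ A' * ρ ^ j := by
    intro n x hx j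
    rw [dist_eq_norm]
    refine (hcauchy j n x hx).trans ?_
    have : ‖x‖ ^ (k + 1) ≤ 1 :=
      pow_le_one₀ (norm_nonneg _) ((mem_ball_zero_iff.1 hx).trans_le hr1).le
    gcongr
    exact mul_le_of_le_one_right hA'0.le this
  have hex : ∀ n x, ∃ y, x ∈ ball (0 : ℂ × ℂ) r → Tendsto (fun j => P j n x) atTop (𝓝 y) := by
    intro n x
    by_cases hx : x ∈ ball (0 : ℂ × ℂ) r
    · obtain ⟨y, hy⟩ := cauchySeq_tendsto_of_complete
        (cauchySeq_of_le_geometric ρ A' hρ1 (hdist n x hx))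
      exact ⟨y, fun _ => hy⟩
    · exact ⟨0, fun h => absurd h hx⟩
  choose Φ hΦ using hex
  have hΦclose : ∀ n, ∀ x ∈ ball (0 : ℂ × ℂ) r, ‖Φ n x - h n x‖ ≤ A' * ‖x‖ ^ (k + 1) :=
    fun n x hx => le_of_tendsto ((hΦ n x hx).sub_const (h n x)).norm
      (Eventually.of_forall fun j => hclose j n x hx)
  have hΦη : ∀ n, ∀ x ∈ ball (0 : ℂ × ℂ) r, Φ n x ∈ ball 0 η := fun n x hx =>
    hsmall n x hx _ (hΦclose n x hx)
  have hunif : ∀ n, TendstoUniformlyOn (fun j => P j n) (Φ n) atTop (ball 0 r) := by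
    intro n
    rw [Metric.tendstoUniformlyOn_iff]
    intro ε hε
    have hlim : Tendsto (fun j => A' * ρ ^ j / (1 - ρ)) atTop (𝓝 0) := by
      simpa using ((tendsto_pow_atTop_nhds_zero_of_lt_one hρ0 hρ1).const_mul A').div_const (1 - ρ)
    filter_upwards [hlim.eventually_lt_const hε] with j hj x hx
    rw [dist_comm]
    exact (dist_le_of_le_geometric_of_tendsto ρ A' hρ1 (hdist n x hx) (hΦ n x hx) j).trans_lt hj
  have hPan : ∀ j n, AnalyticOnNhd ℂ (P j n) (ball 0 r) := by
    intro j
    induction j with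
    | zero => exact fun n => (hh n).mono (ball_subset_ball hr1)
    | succ j ih =>
      exact fun n => (hginv n).comp ((ih (n + 1)).comp ((hf n).mono (subset_univ _)) (hfr n))
        (mapsTo_univ _ _)
  have hmem0 : (0 : ℂ × ℂ) ∈ ball (0 : ℂ × ℂ) r := mem_ball_self hr0
  have hΦ0 : ∀ n, Φ n 0 = 0 := by
    intro n
    have := hΦclose n 0 hmem0
    simpa [hh0] using this
  refine ⟨r, hr0, hr1, Φ, fun n => ⟨analyticOnNhd_of_tendstoUniformlyOn (fun j => hPan j n)
    (hunif n), fun x hx => hη1 _ (hΦη n x hx), hΦ0 n, ?_, fun x hx => ?_⟩⟩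
  · have h1 : HasFDerivAt (fun x => Φ n x - h n x) (0 : ℂ × ℂ →L[ℂ] ℂ × ℂ) 0 := by
      refine IsBigO.hasFDerivAt (n := k + 1) (IsBigO.of_bound A' ?_) (by omega)
      filter_upwards [ball_mem_nhds 0 hr0] with x hx
      simpa using hΦclose n x hx
    have h2 : HasFDerivAt (h n) (ContinuousLinearMap.id ℂ (ℂ × ℂ)) 0 := by
      rw [← hDh n]
      exact ((hh n).differentiableOn.differentiableAt (ball_mem_nhds 0 one_pos)).hasFDerivAt
    have h3 := h1.add h2
    rw [zero_add] at h3
    refine h3.congr_of_eventuallyEq (Eventually.of_forall fun x => ?_)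
    simp
  · have h1 := hΦ (n + 1) (f n x) (hfr n hx)
    have h2 := (hΦ n x hx).comp (tendsto_add_atTop_nat 1)
    have h3 := ((hg n).continuousOn.continuousAt univ_mem).tendsto.comp h2
    refine tendsto_nhds_unique h3 (h1.congr fun j => ?_)
    simp only [Function.comp, hPsucc]
    exact (hgr n _).symm

theorem IsAutomorphism.comp {f g : ℂ × ℂ → ℂ × ℂ} (hf : IsAutomorphism f)
    (hg : IsAutomorphism g) : IsAutomorphism (f ∘ g) := by
  obtain ⟨hfa, f', hfa', hfl, hfr⟩ := hf
  obtain ⟨hga, g', hga', hgl, hgr⟩ := hg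
  exact ⟨hfa.comp hga (mapsTo_univ _ _), g' ∘ f', hga'.comp hfa' (mapsTo_univ _ _),
    hfl.comp hgl, hfr.comp hgr⟩

theorem IsAutomorphism.seqComp {f : ℕ → ℂ × ℂ → ℂ × ℂ} (hf : ∀ n, IsAutomorphism (f n)) (n : ℕ) :
    IsAutomorphism (seqComp f n) := by
  induction n with
  | zero => exact hf 0
  | succ n ih => exact (hf (n + 1)).comp ih

theorem seqComp_succ_apply (f : ℕ → ℂ × ℂ → ℂ × ℂ) (n : ℕ) (z : ℂ × ℂ) :
    seqComp f (n + 1) z = f (n + 1) (seqComp f n z) := rfl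

/-- An orbit entering the unit ball converges to the origin. -/
theorem mem_basin_of_norm_lt_one {f : ℕ → ℂ × ℂ → ℂ × ℂ} {D : ℝ} (hD0 : 0 ≤ D) (hD : D < 1)
    (hfD : ∀ n z, ‖z‖ < 1 → ‖f n z‖ ≤ D * ‖z‖) {n : ℕ} {z : ℂ × ℂ} (hz : ‖seqComp f n z‖ < 1) :
    z ∈ basin f := by
  have h : ∀ j, ‖seqComp f (j + n) z‖ ≤ D ^ j ∧ ‖seqComp f (j + n) z‖ < 1 := by
    intro j
    induction j with
    | zero => simpa using ⟨hz.le, hz⟩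
    | succ j ih =>
      have h1 := hfD (j + n + 1) _ ih.2
      rw [Nat.add_right_comm, seqComp_succ_apply, pow_succ']
      exact ⟨h1.trans (by gcongr; exact ih.1),
        h1.trans_lt ((mul_le_of_le_one_left (norm_nonneg _) hD.le).trans_lt ih.2)⟩
  have hlim : Tendsto (fun j => seqComp f (j + n) z) atTop (𝓝 0) :=
    squeeze_zero_norm (fun j => (h j).1) (tendsto_pow_atTop_nhds_zero_of_lt_one hD0 hD)
  exact (tendsto_add_atTop_iff_nat n).1 hlim

theorem exists_norm_seqComp_lt {f : ℕ → ℂ × ℂ → ℂ × ℂ} {s : ℝ} (hs : 0 < s) {z : ℂ × ℂ}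
    (hz : z ∈ basin f) : ∃ n, seqComp f n z ∈ ball 0 s :=
  (Tendsto.eventually (show Tendsto _ _ _ from hz) (ball_mem_nhds 0 hs)).exists

/-- A continuous linear endomorphism that is close to the identity is invertible. -/
theorem exists_equiv_of_norm_sub_id_lt_one {E : Type*} [NormedAddCommGroup E] [NormedSpace ℂ E]
    [CompleteSpace E] {T : E →L[ℂ] E} (hT : ‖T - ContinuousLinearMap.id ℂ E‖ < 1) :
    ∃ i : E ≃L[ℂ] E, T = i := by
  have h : ‖(1 : E →L[ℂ] E) - T‖ < 1 := by rwa [norm_sub_rev]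
  refine ⟨ContinuousLinearEquiv.ofUnit (Units.oneSub (1 - T) h), ?_⟩
  ext x
  change T x = ((Units.oneSub (1 - T) h : (E →L[ℂ] E)ˣ) : E →L[ℂ] E) x
  simp

/-- A uniformly bounded family of holomorphic maps tangent to the identity is uniformly locally
invertible, with analytic inverses. -/
theorem exists_uniform_inverse (E : Type*) [NormedAddCommGroup E] [NormedSpace ℂ E]
    [CompleteSpace E] [Nontrivial E] {r M : ℝ} (hr : 0 < r) (hM : 0 ≤ M) :
    ∃ s > 0, s ≤ r ∧ ∀ φ : E → E, AnalyticOnNhd ℂ φ (ball 0 r) →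
      (∀ x ∈ ball 0 r, ‖φ x‖ ≤ M) → φ 0 = 0 →
      HasFDerivAt φ (ContinuousLinearMap.id ℂ E) 0 →
      InjOn φ (ball 0 s) ∧ ∃ ψ : E → E, ∀ w ∈ ball 0 (s / 4),
        AnalyticAt ℂ ψ w ∧ ψ w ∈ ball 0 s ∧ φ (ψ w) = w := by
  obtain ⟨s, hs, hsr, H⟩ := exists_lipschitz_of_fderiv_eq_zero E E hr (add_nonneg hM hr.le)
    (one_half_pos (α := ℝ))
  refine ⟨s, hs, hsr, fun φ hφ hb h0 h1 => ?_⟩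
  have hlip := H (fun x => φ x - x) (hφ.differentiableOn.sub differentiableOn_id)
    (fun z hz => (norm_sub_le _ _).trans
      (add_le_add (hb z hz) (mem_ball_zero_iff.1 hz).le)) (by simp [h0])
    ((h1.sub (hasFDerivAt_id (𝕜 := ℂ) (0 : E))).fderiv.trans (sub_self _))
  have happrox : ApproximatesLinearOn φ (ContinuousLinearEquiv.refl ℂ E : E →L[ℂ] E)
      (ball 0 s) (1 / 2) := by
    intro x hx y hy
    refine le_of_eq_of_le ?_ ((hlip x hx y hy).trans_eq (by simp))
    congr 1
    simp
    abel
  have hN : ‖((ContinuousLinearEquiv.refl ℂ E).symm : E →L[ℂ] E)‖₊ = 1 := by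
    ext
    exact ContinuousLinearMap.norm_id
  have hc : Subsingleton E ∨
      (1 / 2 : NNReal) < ‖((ContinuousLinearEquiv.refl ℂ E).symm : E →L[ℂ] E)‖₊⁻¹ := by
    right
    rw [hN, inv_one]
    exact NNReal.half_lt_self one_ne_zero
  set e := happrox.toOpenPartialHomeomorph φ (ball 0 s) hc isOpen_ball with he
  have htarget : ball 0 (s / 4) ⊆ e.target := by
    have h2 := happrox.closedBall_subset_target hc isOpen_ball (b := 0) (ε := s / 2)
      (half_pos hs).le (closedBall_subset_ball (half_lt_self hs))
    rw [h0, hN] at h2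
    refine (ball_subset_closedBall.trans (closedBall_subset_closedBall ?_)).trans h2
    norm_num
    linarith
  refine ⟨e.injOn, e.symm, fun w hw => ?_⟩
  have hmem : e.symm w ∈ ball 0 s := e.map_target (htarget hw)
  have hmem' := ball_subset_ball hsr hmem
  have hder := (hφ _ hmem').differentiableAt.hasFDerivAt
  obtain ⟨i, hi⟩ := exists_equiv_of_norm_sub_id_lt_one (T := fderiv ℂ φ (e.symm w)) <| by
    refine lt_of_le_of_lt ?_ one_half_lt_one
    refine (hder.sub (hasFDerivAt_id (𝕜 := ℂ) (e.symm w))).le_of_lip' (by norm_num) ?_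
    filter_upwards [isOpen_ball.mem_nhds hmem] with x hx using hlip x hx _ hmem
  exact ⟨e.analyticAt_symm (htarget hw) (hφ _ hmem') hi, hmem, e.right_inv (htarget hw)⟩

/-- Two attracting sequences that are conjugate on a fixed ball by injective maps whose images
contain a fixed ball have biholomorphic basins. -/
theorem biholomorphicTo_basin_of_exact_conjugation {f g Φ ψ : ℕ → ℂ × ℂ → ℂ × ℂ} {D s t : ℝ}
    (hD0 : 0 ≤ D) (hD : D < 1) (hs : 0 < s) (hs1 : s ≤ 1) (ht : 0 < t)
    (hf : ∀ n, IsAutomorphism (f n)) (hg : ∀ n, IsAutomorphism (g n))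
    (hfD : ∀ n z, ‖z‖ < 1 → ‖f n z‖ ≤ D * ‖z‖) (hgD : ∀ n z, ‖z‖ < 1 → ‖g n z‖ ≤ D * ‖z‖)
    (hΦ : ∀ n, AnalyticOnNhd ℂ (Φ n) (ball 0 s)) (hΦ1 : ∀ n, ∀ x ∈ ball 0 s, ‖Φ n x‖ < 1)
    (hconj : ∀ n, ∀ x ∈ ball 0 s, g n (Φ n x) = Φ (n + 1) (f n x))
    (hinj : ∀ n, InjOn (Φ n) (ball 0 s))
    (hψ : ∀ n, ∀ w ∈ ball 0 t, AnalyticAt ℂ (ψ n) w ∧ ψ n w ∈ ball 0 s ∧ Φ n (ψ n w) = w) :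
    BiholomorphicTo (basin f) (basin g) := by
  have hF := IsAutomorphism.seqComp hf
  have hG := IsAutomorphism.seqComp hg
  choose hFa Finv hFinva hFl hFr using hF
  choose hGa Ginv hGinva hGl hGr using hG
  have han {u : ℂ × ℂ → ℂ × ℂ} (hu : AnalyticOn ℂ u univ) (z : ℂ × ℂ) : AnalyticAt ℂ u z :=
    isOpen_univ.analyticOn_iff_analyticOnNhd.1 hu z (mem_univ z)
  let R : ℕ → ℂ × ℂ → ℂ × ℂ → Prop := fun n z w =>
    seqComp f n z ∈ ball 0 s ∧ seqComp g n w = Φ (n + 1) (seqComp f n z)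
  have hsucc : ∀ n z w, R n z w → R (n + 1) z w := by
    rintro n z w ⟨h1, h2⟩
    refine ⟨?_, ?_⟩
    · rw [mem_ball_zero_iff] at h1 ⊢
      rw [seqComp_succ_apply]
      exact ((hfD _ _ (h1.trans_le hs1)).trans
        (mul_le_of_le_one_left (norm_nonneg _) hD.le)).trans_lt h1
    · rw [seqComp_succ_apply, seqComp_succ_apply, h2, hconj _ _ h1]
  have hmono : ∀ {n m z w}, n ≤ m → R n z w → R m z w := fun {n m z w} hnm h =>
    Nat.le_induction h (fun j _ hj => hsucc j z w hj) m hnm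
  have hRf : ∀ {n z w}, R n z w → z ∈ basin f := fun h =>
    mem_basin_of_norm_lt_one hD0 hD hfD ((mem_ball_zero_iff.1 h.1).trans_le hs1)
  have hRg : ∀ {n z w}, R n z w → w ∈ basin g := fun {n z w} h =>
    mem_basin_of_norm_lt_one hD0 hD hgD (n := n) (by rw [h.2]; exact hΦ1 _ _ h.1)
  have huniq : ∀ {n m z w w'}, R n z w → R m z w' → w = w' := fun {n m z w w'} h h' =>
    (hGl (max n m)).injective ((hmono (le_max_left n m) h).2.trans
      (hmono (le_max_right n m) h').2.symm)
  have huniq' : ∀ {n m z z' w}, R n z w → R m z' w → z = z' := by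
    intro n m z z' w h h'
    have h1 := hmono (le_max_left n m) h
    have h2 := hmono (le_max_right n m) h'
    exact (hFl (max n m)).injective (hinj _ h1.1 h2.1 (h1.2.symm.trans h2.2))
  have hfwd : ∀ n z, seqComp f n z ∈ ball 0 s → R n z (Ginv n (Φ (n + 1) (seqComp f n z))) :=
    fun n z hz => ⟨hz, hGr n _⟩
  have hbwd : ∀ n w, seqComp g n w ∈ ball 0 t →
      R n (Finv n (ψ (n + 1) (seqComp g n w))) w := by
    intro n w hw
    obtain ⟨-, h1, h2⟩ := hψ (n + 1) _ hw
    refine ⟨?_, ?_⟩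
    · rwa [hFr n]
    · rw [hFr n, h2]
  have hex : ∀ z, ∃ w, z ∈ basin f → ∃ n, R n z w := by
    intro z
    by_cases hz : z ∈ basin f
    · obtain ⟨n, hn⟩ := exists_norm_seqComp_lt hs hz
      exact ⟨_, fun _ => ⟨n, hfwd n z hn⟩⟩
    · exact ⟨0, fun h => absurd h hz⟩
  have hex' : ∀ w, ∃ z, w ∈ basin g → ∃ n, R n z w := by
    intro w
    by_cases hw : w ∈ basin g
    · obtain ⟨n, hn⟩ := exists_norm_seqComp_lt ht hw
      exact ⟨_, fun _ => ⟨n, hbwd n w hn⟩⟩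
    · exact ⟨0, fun h => absurd h hw⟩
  choose A hA using hex
  choose A' hA' using hex'
  refine ⟨A, A', fun z hz => ?_, fun w hw => ?_, fun z hz => ?_, fun w hw => ?_,
    fun z hz => ?_, fun w hw => ?_⟩
  · obtain ⟨n, hn⟩ := exists_norm_seqComp_lt hs hz
    have h1 : AnalyticAt ℂ (fun x => Ginv n (Φ (n + 1) (seqComp f n x))) z :=
      (han (hGinva n) _).fun_comp ((hΦ _ _ hn).fun_comp (han (hFa n) z))
    refine (h1.congr ?_).analyticWithinAt
    filter_upwards [(han (hFa n) z).continuousAt.preimage_mem_nhds (isOpen_ball.mem_nhds hn)]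
      with x hx
    have h2 := hfwd n x hx
    obtain ⟨m, hm⟩ := hA x (hRf h2)
    exact huniq h2 hm
  · obtain ⟨n, hn⟩ := exists_norm_seqComp_lt ht hw
    have h1 : AnalyticAt ℂ (fun x => Finv n (ψ (n + 1) (seqComp g n x))) w :=
      (han (hFinva n) _).fun_comp ((hψ _ _ hn).1.fun_comp (han (hGa n) w))
    refine (h1.congr ?_).analyticWithinAt
    filter_upwards [(han (hGa n) w).continuousAt.preimage_mem_nhds (isOpen_ball.mem_nhds hn)]
      with x hx
    have h2 := hbwd n x hx
    obtain ⟨m, hm⟩ := hA' x (hRg h2)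
    exact huniq' h2 hm
  · obtain ⟨n, hn⟩ := hA z hz
    exact hRg hn
  · obtain ⟨n, hn⟩ := hA' w hw
    exact hRf hn
  · obtain ⟨n, hn⟩ := hA z hz
    obtain ⟨m, hm⟩ := hA' _ (hRg hn)
    exact huniq' hm hn
  · obtain ⟨n, hn⟩ := hA' w hw
    obtain ⟨m, hm⟩ := hA _ (hRf hn)
    exact huniq hm hn

/-- Non-autonomous conjugation lemma: if `(g n ∘ h n)` and `(h (n+1) ∘ f n)` agree as
germs of order `k` at the origin, with `(h n)` uniformly bounded, fixing `0` and tangent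
to the identity, and `D^(k+1) < C`, then the basins of `(f n)` and `(g n)` are
biholomorphic. -/
theorem basin_biholomorphic_of_conjugation
    (f g h : ℕ → (ℂ × ℂ) → (ℂ × ℂ)) (C D : ℝ) (k : ℕ)
    (hC : 0 < C) (hCD : C < D) (hD : D < 1) (hk : 1 ≤ k)
    (hautf : ∀ n, IsAutomorphism (f n))
    (hautg : ∀ n, IsAutomorphism (g n))
    (hattrf : UniformlyAttracting f C D)
    (hattrg : UniformlyAttracting g C D)
    (hDC : D ^ (k + 1) < C)
    (hhol : ∀ n, AnalyticOn ℂ (h n) (ball (0 : ℂ × ℂ) 1))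
    (hbdd : ∃ B : ℝ, ∀ n, ∀ z : ℂ × ℂ, ‖z‖ < 1 → ‖h n z‖ ≤ B)
    (hh0 : ∀ n, h n 0 = 0)
    (hDh : ∀ n, fderiv ℂ (h n) 0 = ContinuousLinearMap.id ℂ (ℂ × ℂ))
    (htaylor : ∀ n, ∀ i : ℕ, i ≤ k →
      iteratedFDeriv ℂ i (g n ∘ h n) 0 = iteratedFDeriv ℂ i (h (n + 1) ∘ f n) 0) :
    BiholomorphicTo (basin f) (basin g) := by
  have hD0 : 0 < D := hC.trans hCD
  obtain ⟨B₀, hB₀⟩ := hbdd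
  set B := max B₀ 1 with hB
  have hann {u : ℂ × ℂ → ℂ × ℂ} (hu : AnalyticOn ℂ u univ) : AnalyticOnNhd ℂ u univ :=
    isOpen_univ.analyticOn_iff_analyticOnNhd.1 hu
  have hh : ∀ n, AnalyticOnNhd ℂ (h n) (ball 0 1) := fun n =>
    isOpen_ball.analyticOn_iff_analyticOnNhd.1 (hhol n)
  have hhB : ∀ n z, ‖z‖ < 1 → ‖h n z‖ ≤ B * ‖z‖ := by
    intro n z hz
    have hmaps : MapsTo (h n) (ball 0 1) (closedBall (h n 0) B) := fun x hx => by
      rw [hh0, mem_closedBall_zero_iff]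
      exact (hB₀ n x (mem_ball_zero_iff.1 hx)).trans (le_max_left _ _)
    simpa [hh0] using Complex.dist_le_div_mul_dist_of_mapsTo_ball (hh n).differentiableOn hmaps
      (mem_ball_zero_iff.2 hz)
  have hautg' := hautg
  choose hga ginv hginv hgl hgr using hautg'
  obtain ⟨r, hr, hr1, Φ, hΦ⟩ := exists_exact_conjugation (le_max_right B₀ 1) hD0 hD hk hDC
    (fun n => hann (hautf n).1) (fun n => hann (hga n)) (fun n => hann (hginv n)) hgl hgr
    hattrf.1 hattrg.1 (fun n z hz => (hattrf.2 n z hz).2) (fun n z hz => (hattrg.2 n z hz).1)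
    (fun n z hz => (hattrg.2 n z hz).2.trans (mul_le_of_le_one_left (norm_nonneg _) hD.le))
    hh hh0 hDh hhB htaylor
  obtain ⟨s, hs, hsr, H⟩ := exists_uniform_inverse (ℂ × ℂ) hr zero_le_one
  have H' := fun n => H (Φ n) (hΦ n).1 (fun x hx => ((hΦ n).2.1 x hx).le) (hΦ n).2.2.1
    (hΦ n).2.2.2.1
  choose hinj ψ hψ using H'
  have hsub : ball (0 : ℂ × ℂ) s ⊆ ball 0 r := ball_subset_ball hsr
  exact biholomorphicTo_basin_of_exact_conjugation hD0.le hD hs (hsr.trans hr1)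
    (by positivity : 0 < s / 4) hautf hautg (fun n z hz => (hattrf.2 n z hz).2)
    (fun n z hz => (hattrg.2 n z hz).2) (fun n => (hΦ n).1.mono hsub)
    (fun n x hx => (hΦ n).2.1 x (hsub hx)) (fun n x hx => (hΦ n).2.2.2.2 x (hsub hx)) hinj hψ
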